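/- Let G be a finite group and χ an irreducible complex character of G of degree r = χ(1). For each prime p dividing |G|, fix a Sylow p-subgroup S_p of G with |S_p| = p^{k_p}, and choose any integers u_p, v_p satisfying u_p·r + v_p·p^{k_p} = gcd(r, p^{k_p}); let χ_p = u_p·(χ restricted to S_p) + v_p·ρ_reg^{S_p} be the resulting virtual character of S_p (its degree is gcd(r, p^{k_p}) > 0). Then K(χ) = ∏_{p | |G|} K(χ_p); in particular this product is independent of the choices of u_p and v_p. -/

import Mathlib

open scoped ComplexOrder

noncomputable section

/-- `χ : G → ℂ` is an irreducible character: the character of a simple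
finite-dimensional complex representation of `G`. -/
def IsIrrChar (G : Type) [Group G] (χ : G → ℂ) : Prop :=
  ∃ V : FDRep ℂ G, CategoryTheory.Simple V ∧ χ = V.character

/-- A virtual character is a `ℤ`-linear combination of irreducible characters. -/
def IsVirtualChar (G : Type) [Group G] (χ : G → ℂ) : Prop :=
  χ ∈ Submodule.span ℤ {f : G → ℂ | IsIrrChar G f}

open Classical in
/-- The regular character: `|G|` at the identity, `0` elsewhere. -/
def regChar (G : Type) [Group G] : G → ℂ :=
  fun g => if g = 1 then (Nat.card G : ℂ) else 0

/-- The Knutson index of `χ`: the least positive `n` such that `χ·φ = n·ρ_reg`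
for some virtual character `φ`. -/
def KnutsonIndex (G : Type) [Group G] (χ : G → ℂ) : ℕ :=
  sInf {n : ℕ | 0 < n ∧ ∃ φ : G → ℂ, IsVirtualChar G φ ∧ χ * φ = n • regChar G}

/-- `ℂ[G]` is of Knutson type: every irreducible character is regular invertible. -/
def IsKnutsonType (G : Type) [Group G] : Prop :=
  ∀ χ : G → ℂ, IsIrrChar G χ → ∃ φ : G → ℂ, IsVirtualChar G φ ∧ χ * φ = regChar G

/-- Savitskii's preorder: `φ ≤ χ` iff `φ(1) ≤ χ(1)` and every zero of `χ` is a zero of `φ`. -/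
def SavitskiiLE (G : Type) [Group G] (φ χ : G → ℂ) : Prop :=
  φ 1 ≤ χ 1 ∧ ∀ g : G, χ g = 0 → φ g = 0

/-- A virtual character of positive degree is Savitskii-minimal if every virtual
character of positive degree below it is also above it. -/
def SavitskiiMinimal (G : Type) [Group G] (χ : G → ℂ) : Prop :=
  ∀ φ : G → ℂ, IsVirtualChar G φ → 0 < φ 1 → SavitskiiLE G φ χ → SavitskiiLE G χ φ

end

section CharacterTheory

open Module

variable {G : Type} [Group G]

namespace Representation

variable {V : Type} [AddCommGroup V] [Module ℂ V] [FiniteDimensional ℂ V]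

theorem isIrrChar_character [Finite G] (ρ : Representation ℂ G V) [IsIrreducible ρ] :
    IsIrrChar G ρ.character := by
  have := Fintype.ofFinite G
  have := invertibleOfNonzero (NeZero.ne (Nat.card G : ℂ))
  refine ⟨FDRep.of ρ, ?_, rfl⟩
  rw [FDRep.simple_iff_char_is_norm_one]
  have h := char_orthonormal ρ ρ
  rw [if_pos ⟨Equiv.refl ρ⟩, inv_mul_eq_one₀ (NeZero.ne _)] at h
  exact h.symm

theorem character_eq_add_of_isCompl (ρ : Representation ℂ G V) {σ τ : Subrepresentation ρ}
    (h : IsCompl σ.toSubmodule τ.toSubmodule) :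
    ρ.character = σ.toRepresentation.character + τ.toRepresentation.character := by
  ext g
  have key : ρ g = (Submodule.prodEquivOfIsCompl _ _ h).conj
      ((σ.toRepresentation g).prodMap (τ.toRepresentation g)) := by
    ext v
    obtain ⟨x, rfl⟩ := (Submodule.prodEquivOfIsCompl _ _ h).surjective v
    simp [LinearEquiv.conj_apply, Subrepresentation.toRepresentation]
  rw [character, key, LinearMap.trace_conj', LinearMap.trace_prodMap']
  rfl

theorem isVirtualChar_character [Finite G] (ρ : Representation ℂ G V) :
    IsVirtualChar G ρ.character := by
  induction h : finrank ℂ V using Nat.strong_induction_on generalizing V with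
  | _ n ih =>
    subst h
    by_cases hirr : IsIrreducible ρ
    · exact Submodule.subset_span (isIrrChar_character ρ)
    by_cases h0 : finrank ℂ V = 0
    · have : Subsingleton V := finrank_zero_iff.mp h0
      have : ρ.character = 0 := by
        ext g
        simp [character, Subsingleton.elim (ρ g) 0]
      rw [this]
      exact Submodule.zero_mem _
    · have hV : Nontrivial V := nontrivial_of_finrank_pos (Nat.pos_of_ne_zero h0)
      have hbt : (⊥ : Subrepresentation ρ).toSubmodule ≠ (⊤ : Subrepresentation ρ).toSubmodule :=
        bot_ne_top (α := Submodule ℂ V)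
      have hnt : Nontrivial (Subrepresentation ρ) :=
        ⟨⊥, ⊤, fun h => hbt (congrArg Subrepresentation.toSubmodule h)⟩
      have : ∃ σ : Subrepresentation ρ, σ ≠ ⊥ ∧ σ ≠ ⊤ := by
        by_contra! hcon
        exact hirr ⟨fun σ => or_iff_not_imp_left.mpr (hcon σ)⟩
      obtain ⟨σ, hσb, hσt⟩ := this
      obtain ⟨τ, hτ⟩ := exists_isCompl σ
      have hc : IsCompl σ.toSubmodule τ.toSubmodule := by
        constructor
        · rw [disjoint_iff]
          exact congrArg Subrepresentation.toSubmodule hτ.inf_eq_bot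
        · rw [codisjoint_iff]
          exact congrArg Subrepresentation.toSubmodule hτ.sup_eq_top
      have hσb' : σ.toSubmodule ≠ ⊥ := fun h =>
        hσb (Subrepresentation.toSubmodule_injective h)
      have hσt' : σ.toSubmodule ≠ ⊤ := fun h =>
        hσt (Subrepresentation.toSubmodule_injective h)
      have hsum := Submodule.finrank_add_eq_of_isCompl hc
      have h1 : 0 < finrank ℂ σ.toSubmodule :=
        Nat.pos_of_ne_zero fun h => hσb' (Submodule.finrank_eq_zero.mp h)
      have h2 := Submodule.finrank_lt hσt'
      rw [character_eq_add_of_isCompl ρ hc]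
      exact Submodule.add_mem _ (ih _ h2 _ rfl) (ih _ (by omega) _ rfl)

end Representation

theorem isVirtualChar_one [Finite G] : IsVirtualChar G 1 := by
  have : (1 : G → ℂ) = (1 : Representation ℂ G ℂ).character := by
    ext g
    simp [Representation.character]
  rw [this]
  exact Representation.isVirtualChar_character _

theorem IsVirtualChar.comap {H : Type} [Group H] [Finite H] {φ : G → ℂ} (hφ : IsVirtualChar G φ)
    (f : H →* G) : IsVirtualChar H (φ ∘ f) := by
  induction hφ using Submodule.span_induction with
  | mem φ h =>
    obtain ⟨V, -, rfl⟩ := h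
    exact Representation.isVirtualChar_character (V := V) (MonoidHom.comp V.ρ f)
  | zero => exact Submodule.zero_mem _
  | add φ ψ _ _ h₁ h₂ => exact Submodule.add_mem _ h₁ h₂
  | smul n φ _ h => exact Submodule.smul_mem _ n h

theorem IsVirtualChar.exists_apply_one_eq {φ : G → ℂ} (hφ : IsVirtualChar G φ) :
    ∃ n : ℤ, φ 1 = n := by
  induction hφ using Submodule.span_induction with
  | mem φ h =>
    obtain ⟨V, -, rfl⟩ := h
    exact ⟨finrank ℂ V, by simp⟩
  | zero => exact ⟨0, by simp⟩
  | add φ ψ _ _ h₁ h₂ =>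
    obtain ⟨a, ha⟩ := h₁
    obtain ⟨b, hb⟩ := h₂
    exact ⟨a + b, by simp [ha, hb]⟩
  | smul n φ _ h =>
    obtain ⟨a, ha⟩ := h
    exact ⟨n * a, by simp [ha]⟩

theorem LinearMap.trace_pi {R ι W : Type*} [CommRing R] [Fintype ι] [DecidableEq ι]
    [AddCommGroup W] [Module R W] [Module.Free R W] [Module.Finite R W]
    (T : (ι → W) →ₗ[R] (ι → W)) :
    trace R (ι → W) T = ∑ i, trace R W (proj i ∘ₗ T ∘ₗ single R (fun _ => W) i) := by
  have key : T = ∑ i, (T ∘ₗ single R (fun _ => W) i) ∘ₗ proj i := by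
    refine LinearMap.ext fun f => ?_
    rw [sum_apply]
    simp only [comp_apply, proj_apply, ← map_sum]
    exact congrArg T (Finset.univ_sum_single f).symm
  conv_lhs => rw [key]
  rw [map_sum]
  exact Finset.sum_congr rfl fun i _ => trace_comp_comm' _ _

open Classical in
/-- The class function on `G` induced from a function on the subgroup `H`. -/
noncomputable def inducedFun {G : Type} [Group G] [Fintype G] (H : Subgroup G) (ψ : H → ℂ) :
    G → ℂ :=
  fun g => (Nat.card H : ℂ)⁻¹ *
    ∑ x : G, if h : x * g * x⁻¹ ∈ H then ψ ⟨x * g * x⁻¹, h⟩ else 0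

namespace Representation

variable {G : Type} [Group G] {H : Subgroup G}
  {W : Type} [AddCommGroup W] [Module ℂ W]

/-- `G` acting by right translation on functions `G → W`. -/
def rightTranslation (G W : Type) [Group G] [AddCommGroup W] [Module ℂ W] :
    Representation ℂ G (G → W) where
  toFun g := LinearMap.funLeft ℂ W (· * g)
  map_one' := by ext; simp [LinearMap.funLeft]
  map_mul' a b := by
    refine LinearMap.ext fun f => funext fun x => ?_
    simp [LinearMap.funLeft_apply, mul_assoc]

@[simp]
theorem rightTranslation_apply (g : G) (f : G → W) (x : G) :
    rightTranslation G W g f x = f (x * g) := rfl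

variable [Fintype G]

open Classical in
/-- The averaging projection of `G → W` onto the `H`-equivariant functions. -/
noncomputable def equivariantAverage (σ : Representation ℂ H W) : (G → W) →ₗ[ℂ] (G → W) :=
  (Nat.card H : ℂ)⁻¹ • ∑ s : H, LinearMap.pi fun x => σ s⁻¹ ∘ₗ LinearMap.proj ((s : G) * x)

open Classical in
theorem equivariantAverage_apply (σ : Representation ℂ H W) (f : G → W) (x : G) :
    equivariantAverage σ f x = (Nat.card H : ℂ)⁻¹ • ∑ s : H, σ s⁻¹ (f (s * x)) := by
  simp [equivariantAverage]

theorem equivariantAverage_idem (σ : Representation ℂ H W) (f : G → W) :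
    equivariantAverage σ (equivariantAverage σ f) = equivariantAverage σ f := by
  classical
  funext x
  rw [equivariantAverage_apply]
  have h : ∀ s : H, σ s⁻¹ (equivariantAverage σ f (s * x)) = equivariantAverage σ f x := by
    intro s
    rw [equivariantAverage_apply, equivariantAverage_apply, map_smul, map_sum]
    congr 1
    refine Fintype.sum_equiv (Equiv.mulRight s) _ _ fun t => ?_
    rw [Equiv.coe_mulRight, mul_inv_rev, map_mul, Subgroup.coe_mul, mul_assoc]
    rfl
  rw [Finset.sum_congr rfl fun s _ => h s, Finset.sum_const, Finset.card_univ,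
    ← Nat.card_eq_fintype_card, ← Nat.cast_smul_eq_nsmul ℂ, smul_smul,
    inv_mul_cancel₀ (NeZero.ne _), one_smul]

theorem equivariantAverage_rightTranslation (σ : Representation ℂ H W) (g : G) (f : G → W) :
    equivariantAverage σ (rightTranslation G W g f) =
      rightTranslation G W g (equivariantAverage σ f) := by
  classical
  funext x
  simp [equivariantAverage_apply, mul_assoc]

/-- The representation of `G` induced from `σ`, as the `H`-equivariant functions `G → W`. -/
noncomputable def inducedSubrepresentation (σ : Representation ℂ H W) :
    Subrepresentation (rightTranslation G W) where
  toSubmodule := LinearMap.range (equivariantAverage σ)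
  apply_mem_toSubmodule := by
    rintro g _ ⟨f, rfl⟩
    exact ⟨_, equivariantAverage_rightTranslation σ g f⟩

theorem character_inducedSubrepresentation [FiniteDimensional ℂ W] (σ : Representation ℂ H W) :
    (inducedSubrepresentation σ).toRepresentation.character = inducedFun H σ.character := by
  classical
  ext g
  set E := equivariantAverage (G := G) σ with hE
  have h₁ : (inducedSubrepresentation σ).toRepresentation g =
      E.rangeRestrict ∘ₗ (rightTranslation G W g ∘ₗ (LinearMap.range E).subtype) := by
    refine LinearMap.ext ?_
    rintro ⟨_, f, rfl⟩
    refine Subtype.ext ?_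
    change rightTranslation G W g (E f) = E (rightTranslation G W g (E f))
    rw [hE, equivariantAverage_rightTranslation, equivariantAverage_idem]
  rw [character, h₁]
  refine (LinearMap.trace_comp_comm' _ _).trans ?_
  change LinearMap.trace ℂ (G → W) (rightTranslation G W g ∘ₗ E) = _
  rw [LinearMap.trace_pi, inducedFun, Finset.mul_sum]
  refine Finset.sum_congr rfl fun x _ => ?_
  have h₂ : LinearMap.proj x ∘ₗ (rightTranslation G W g ∘ₗ E) ∘ₗ
        LinearMap.single ℂ (fun _ => W) x =
      (Nat.card H : ℂ)⁻¹ • ∑ s : H, if (s : G) * (x * g) = x then σ s⁻¹ else 0 := by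
    refine LinearMap.ext fun w => ?_
    simp only [LinearMap.comp_apply, LinearMap.proj_apply, rightTranslation_apply, hE,
      equivariantAverage_apply, LinearMap.smul_apply, LinearMap.sum_apply, LinearMap.single_apply]
    congr 1
    refine Finset.sum_congr rfl fun s _ => ?_
    split_ifs with h
    · rw [h, Pi.single_eq_same]
    · rw [Pi.single_eq_of_ne h, map_zero, LinearMap.zero_apply]
  rw [h₂, map_smul, map_sum, smul_eq_mul]
  congr 1
  split_ifs with h
  · rw [Finset.sum_eq_single_of_mem (⟨x * g * x⁻¹, h⟩⁻¹ : H) (Finset.mem_univ _)]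
    · rw [if_pos (by simp [mul_assoc]), inv_inv]
      rfl
    · intro s _ hs
      rw [if_neg, map_zero]
      intro h'
      refine hs (inv_injective (Subtype.ext ?_))
      rw [inv_inv, Subgroup.coe_inv]
      exact inv_eq_of_mul_eq_one_right (by rw [← mul_assoc, mul_inv_eq_one]; exact h')
  · refine Finset.sum_eq_zero fun s _ => ?_
    rw [if_neg, map_zero]
    intro h'
    refine h ?_
    rw [eq_inv_of_mul_eq_one_right (a := (s : G)) (b := x * g * x⁻¹)
      (by rw [← mul_assoc, mul_inv_eq_one]; exact h')]
    exact H.inv_mem s.2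

end Representation

theorem IsVirtualChar.inducedFun {G : Type} [Group G] [Fintype G] {H : Subgroup G} {ψ : H → ℂ}
    (hψ : IsVirtualChar H ψ) : IsVirtualChar G (inducedFun H ψ) := by
  classical
  induction hψ using Submodule.span_induction with
  | mem ψ h =>
    obtain ⟨V, -, rfl⟩ := h
    exact (Representation.character_inducedSubrepresentation (V.ρ : Representation ℂ H V)) ▸
      Representation.isVirtualChar_character _
  | zero =>
    have : _root_.inducedFun H (0 : H → ℂ) = 0 := by ext g; simp [_root_.inducedFun]
    rw [this]
    exact Submodule.zero_mem _
  | add φ ψ _ _ h₁ h₂ =>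
    have : _root_.inducedFun H (φ + ψ) = _root_.inducedFun H φ + _root_.inducedFun H ψ := by
      ext g
      simp only [_root_.inducedFun, Pi.add_apply, ← mul_add, ← Finset.sum_add_distrib]
      congr 2 with x
      split_ifs <;> simp
    rw [this]
    exact Submodule.add_mem _ h₁ h₂
  | smul n φ _ h =>
    have : _root_.inducedFun H (n • φ) = n • _root_.inducedFun H φ := by
      ext g
      simp only [_root_.inducedFun, Pi.smul_apply, ← mul_smul_comm, Finset.smul_sum, smul_dite,
        smul_zero]
    rw [this]
    exact Submodule.smul_mem _ n h

theorem exists_mul_eq_smul_regChar_of_restrict {G : Type} [Group G] [Finite G] {χ : G → ℂ}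
    (hχ : ∀ g h : G, χ (h * g * h⁻¹) = χ g) (H : Subgroup G) {ψ : H → ℂ}
    (hψ : IsVirtualChar H ψ) {n : ℕ} (h : (fun s : H => χ s) * ψ = n • regChar H) :
    ∃ φ : G → ℂ, IsVirtualChar G φ ∧ χ * φ = n • regChar G := by
  classical
  have := Fintype.ofFinite G
  refine ⟨inducedFun H ψ, hψ.inducedFun, funext fun g => ?_⟩
  have hx : ∀ x : G, (χ g * if h : x * g * x⁻¹ ∈ H then ψ ⟨x * g * x⁻¹, h⟩ else 0) =
      if g = 1 then (n * Nat.card H : ℂ) else 0 := by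
    intro x
    split_ifs with h₁ h₂ h₂
    · have := congrFun h ⟨x * g * x⁻¹, h₁⟩
      subst h₂
      simpa [regChar, hχ] using this
    · have := congrFun h ⟨x * g * x⁻¹, h₁⟩
      simpa [regChar, hχ, h₂] using this
    · subst h₂
      exact absurd (by simp) h₁
    · simp
  rw [Pi.mul_apply, inducedFun, mul_left_comm, Finset.mul_sum, Finset.sum_congr rfl fun x _ => hx x,
    Finset.sum_const, Finset.card_univ, ← Nat.card_eq_fintype_card]
  have hH : (Nat.card H : ℂ) ≠ 0 := NeZero.ne _
  by_cases hg : g = 1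
  · simp only [hg, regChar, Pi.smul_apply, if_true, nsmul_eq_mul]
    field_simp
  · simp [hg, regChar]

end CharacterTheory

section Integrality

theorem Int.dvd_of_eq_mul_isIntegral {a b : ℤ} {α : ℂ} (hα : IsIntegral ℤ α)
    (h : (a : ℂ) = b * α) : b ∣ a := by
  by_cases hb : b = 0
  · subst hb
    simpa using h
  have hb' : (b : ℂ) ≠ 0 := by exact_mod_cast hb
  have h₁ : α = algebraMap ℚ ℂ (a / b) := by
    simp [h, hb']
  rw [h₁, isIntegral_algebraMap_iff (algebraMap ℚ ℂ).injective,
    IsIntegrallyClosed.isIntegral_iff] at hα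
  obtain ⟨z, hz⟩ := hα
  have hb'' : (b : ℚ) ≠ 0 := by exact_mod_cast hb
  refine ⟨z, ?_⟩
  rw [eq_div_iff hb''] at hz
  rw [eq_intCast] at hz
  have : z * b = a := by exact_mod_cast hz
  rw [← this, mul_comm]

theorem eq_zero_of_forall_pow_dvd {p m : ℕ} (hp : p.Prime) (hm : ¬ p ∣ m) {y : ℂ}
    (hy : IsIntegral ℤ y)
    (h : ∀ j : ℕ, ∃ (e : ℕ) (α : ℂ), IsIntegral ℤ α ∧ (m : ℂ) ^ e * y = (p : ℂ) ^ j * α) :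
    y = 0 := by
  by_contra hy0
  have h₁ : (Ideal.span {(⟨y, hy⟩ : integralClosure ℤ ℂ)}).comap
      (algebraMap ℤ (integralClosure ℤ ℂ)) ≠ ⊥ :=
    Ideal.comap_ne_bot_of_integral_mem (fun h => hy0 (congrArg Subtype.val h))
      (Ideal.mem_span_singleton_self _) (Algebra.IsIntegral.isIntegral _)
  obtain ⟨z, hz, hz0⟩ := Submodule.exists_mem_ne_zero_of_ne_bot h₁
  rw [Ideal.mem_comap, Ideal.mem_span_singleton] at hz
  obtain ⟨⟨y', hy'⟩, hyy'⟩ := hz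
  have hz' : (z : ℂ) = y * y' := by
    simpa using congrArg Subtype.val hyy'
  have hdvd : ∀ j : ℕ, p ^ j ∣ z.natAbs := by
    intro j
    obtain ⟨e, α, hα, he⟩ := h j
    have h₂ : ((p ^ j : ℕ) : ℤ) ∣ (m ^ e : ℕ) * z := by
      refine Int.dvd_of_eq_mul_isIntegral (hα.mul hy') ?_
      push_cast
      rw [hz', ← mul_assoc, he, mul_assoc]
    have h₃ := Int.natAbs_dvd_natAbs.mpr h₂
    rw [Int.natAbs_mul, Int.natAbs_natCast, Int.natAbs_natCast] at h₃
    exact (((Nat.Prime.coprime_iff_not_dvd hp).mpr hm).pow _ _).dvd_of_dvd_mul_left h₃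
  have := Nat.le_of_dvd (Int.natAbs_pos.mpr hz0) (hdvd z.natAbs)
  exact absurd (Nat.lt_pow_self hp.one_lt) this.not_gt

theorem Representation.isIntegral_character {G V : Type*} [Group G] [Finite G] [AddCommGroup V]
    [Module ℂ V] [FiniteDimensional ℂ V] (ρ : Representation ℂ G V) (g : G) :
    IsIntegral ℤ (ρ.character g) := by
  rw [character, Module.End.trace_eq_sum_roots_charpoly_of_splits (IsAlgClosed.splits _)]
  refine IsIntegral.multiset_sum fun μ hμ => ?_
  rw [Polynomial.mem_roots (ρ g).charpoly_monic.ne_zero,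
    ← Module.End.hasEigenvalue_iff_isRoot_charpoly] at hμ
  obtain ⟨v, hv⟩ := hμ.exists_hasEigenvector
  have h₁ := hv.pow_apply (Nat.card G)
  rw [← map_pow, pow_card_eq_one', map_one, Module.End.one_apply] at h₁
  have h₂ : μ ^ Nat.card G = 1 :=
    smul_left_injective ℂ hv.2 (by simpa using h₁.symm)
  exact IsIntegral.of_pow Nat.card_pos (h₂ ▸ isIntegral_one)

end Integrality

section Convolution

theorem IsIrrChar.exists_convolution_eq {G : Type} [Group G] [Fintype G] {χ : G → ℂ}
    (hχ : IsIrrChar G χ) :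
    ∃ c : ℂ, c * χ 1 = Nat.card G ∧ ∀ h : G, ∑ g : G, χ g⁻¹ * χ (g * h) = c * χ h := by
  obtain ⟨V, hV, rfl⟩ := hχ
  have := invertibleOfNonzero (NeZero.ne (Nat.card G : ℂ))
  have hnorm := (FDRep.simple_iff_char_is_norm_one V).mp hV
  let ρ : Representation ℂ G V := V.ρ
  have hfin : Module.finrank ℂ (Representation.IntertwiningMap ρ ρ) = 1 := by
    have h := Representation.card_inv_mul_sum_char_mul_char_eq_finrank ρ ρ
    have h' : ∑ g : G, ρ.character g * ρ.character g⁻¹ = Nat.card G := hnorm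
    rw [h', inv_mul_cancel₀ (NeZero.ne _)] at h
    exact_mod_cast h.symm
  let T : V →ₗ[ℂ] V := ∑ g : G, ρ.character g⁻¹ • ρ g
  have hT : ∀ h : G, T ∘ₗ ρ h = ρ h ∘ₗ T := by
    intro h
    change T * ρ h = ρ h * T
    simp only [T, Finset.sum_mul, Finset.mul_sum, smul_mul_assoc, mul_smul_comm, ← map_mul]
    refine Fintype.sum_equiv (MulAut.conj h⁻¹).toEquiv _ _ fun g => ?_
    have : h * (h⁻¹ * g * h⁻¹⁻¹) = g * h := by group
    simp only [MulEquiv.toEquiv_eq_coe, MulEquiv.coe_toEquiv, MulAut.conj_apply, this]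
    congr 1
    rw [← Representation.char_conj ρ g⁻¹ h⁻¹]
    congr 1
    group
  let T' : Representation.IntertwiningMap ρ ρ := ⟨T, hT⟩
  have hid : Representation.IntertwiningMap.id ρ ≠ 0 := by
    intro h0
    have : Subsingleton (Representation.IntertwiningMap ρ ρ) := by
      refine subsingleton_of_forall_eq 0 fun f => ?_
      ext v
      have hv : v = 0 := congrArg (fun F : Representation.IntertwiningMap ρ ρ => F v) h0
      subst hv
      simp
    rw [Module.finrank_zero_of_subsingleton] at hfin
    exact zero_ne_one hfin
  obtain ⟨c, hc⟩ := (finrank_eq_one_iff_of_nonzero' _ hid).mp hfin T'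
  have hTc : T = c • LinearMap.id := by
    refine LinearMap.ext fun v => ?_
    exact (congrArg (fun F : Representation.IntertwiningMap ρ ρ => F v) hc).symm
  have hconv : ∀ h : G, ∑ g : G, V.character g⁻¹ * V.character (g * h) = c * V.character h := by
    intro h
    have h₁ : LinearMap.trace ℂ V (T * ρ h) = c * V.character h := by
      rw [hTc, smul_mul_assoc, map_smul, smul_eq_mul]
      rfl
    rw [← h₁]
    simp only [T, Finset.sum_mul, smul_mul_assoc, ← map_mul, map_sum, map_smul, smul_eq_mul]
    rfl
  refine ⟨c, ?_, hconv⟩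
  rw [← hconv 1, ← hnorm]
  exact Finset.sum_congr rfl fun g _ => by rw [mul_one, mul_comm]

end Convolution

section Words

theorem sum_vector_succ {G M : Type*} [Fintype G] [AddCommMonoid M] {n : ℕ}
    (F : List.Vector G (n + 1) → M) :
    ∑ w, F w = ∑ g : G, ∑ w : List.Vector G n, F (g ::ᵥ w) := by
  rw [← Fintype.sum_prod_type']
  symm
  refine Fintype.sum_equiv
    { toFun := fun x => x.1 ::ᵥ x.2
      invFun := fun w => (w.head, w.tail)
      left_inv := fun x => by simp
      right_inv := fun w => by simp } _ _ fun x => rfl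

theorem sum_words_eq_pow_mul_sum {G : Type*} [Group G] [Fintype G] {χ : G → ℂ}
    (hχ : ∀ g h : G, χ (g * h) = χ (h * g)) {c : ℂ}
    (hc : ∀ h : G, ∑ g : G, χ g⁻¹ * χ (g * h) = c * χ h) (n : ℕ) (f : G → ℂ) :
    ∑ w : List.Vector G (n + 1), (w.toList.map fun g => χ g⁻¹).prod * f w.toList.prod =
      c ^ n * ∑ x, χ x⁻¹ * f x := by
  induction n generalizing f with
  | zero =>
    rw [sum_vector_succ]
    simp
  | succ n ih =>
    rw [sum_vector_succ]
    have h₁ : ∀ g : G, ∑ w : List.Vector G (n + 1),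
        ((g ::ᵥ w).toList.map fun g => χ g⁻¹).prod * f (g ::ᵥ w).toList.prod =
        c ^ n * ∑ x, χ g⁻¹ * (χ (g⁻¹ * x)⁻¹ * f x) := by
      intro g
      simp only [List.Vector.toList_cons, List.map_cons, List.prod_cons, mul_assoc]
      rw [← Finset.mul_sum, ih fun x => f (g * x), mul_left_comm, Finset.mul_sum]
      congr 1
      exact Fintype.sum_equiv (Equiv.mulLeft g) _ _ fun x => by simp
    rw [Finset.sum_congr rfl fun g _ => h₁ g, ← Finset.mul_sum, Finset.sum_comm, pow_succ,
      mul_assoc, Finset.mul_sum Finset.univ _ c]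
    congr 1
    refine Finset.sum_congr rfl fun x _ => ?_
    rw [← mul_assoc, ← hc x⁻¹, Finset.sum_mul]
    exact Finset.sum_congr rfl fun g _ => by rw [mul_inv_rev, inv_inv, hχ x⁻¹ g, mul_assoc]

theorem List.eq_prod_pow_of_append_comm {G : Type*} [Monoid G] {a b : List G} {e : ℕ}
    (hlen : b.length = a.length * e) (h : b ++ a = a ++ b) : b.prod = a.prod ^ e := by
  induction e generalizing b with
  | zero =>
    rw [mul_zero, List.length_eq_zero_iff] at hlen
    simp [hlen]
  | succ e ih =>
    have hpre : a <+: b := by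
      refine List.prefix_of_prefix_length_le (List.prefix_append a b) ?_ (by rw [hlen]; nlinarith)
      exact h ▸ List.prefix_append b a
    obtain ⟨b, rfl⟩ := hpre
    rw [List.append_assoc, List.append_cancel_left_eq] at h
    rw [List.length_append, Nat.mul_succ, add_comm, Nat.add_right_cancel_iff] at hlen
    rw [List.prod_append, ih hlen h, pow_succ']

theorem List.exists_prod_eq_pow_of_rotate_eq {G : Type*} [Monoid G] {l : List G} {d e : ℕ}
    (he : e ≠ 0) (hlen : l.length = d * e) (h : l.rotate d = l) : ∃ y : G, l.prod = y ^ e := by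
  obtain ⟨e, rfl⟩ := Nat.exists_eq_succ_of_ne_zero he
  have hd : d ≤ l.length := by rw [hlen]; nlinarith
  rw [List.rotate_eq_drop_append_take hd] at h
  refine ⟨(l.take d).prod, ?_⟩
  have h₁ : (l.take d).length = d := by rw [List.length_take]; omega
  have h₂ := List.eq_prod_pow_of_append_comm (a := l.take d) (b := l.drop d) (e := e)
    (by rw [h₁, List.length_drop, hlen, Nat.mul_succ]; omega)
    (by rw [h, List.take_append_drop])
  conv_lhs => rw [← List.take_append_drop d l]
  rw [List.prod_append, h₂, pow_succ']

theorem List.isConj_prod_rotate {G : Type*} [Group G] (l : List G) (n : ℕ) :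
    IsConj l.prod (l.rotate n).prod := by
  induction n with
  | zero => rw [List.rotate_zero]
  | succ n ih =>
    refine ih.trans ?_
    rw [← List.rotate_rotate]
    rcases l.rotate n with _ | ⟨a, l⟩
    · simp
    · rw [List.rotate_cons_succ, List.rotate_zero, isConj_iff]
      exact ⟨a⁻¹, by simp⟩

/-- Cyclic rotation of words. -/
noncomputable def rotateWord (G : Type*) [Finite G] (n : ℕ) : Equiv.Perm (List.Vector G n) :=
  Equiv.ofBijective (fun w => ⟨w.toList.rotate 1, by simp⟩) <|
    Finite.injective_iff_bijective.mp fun v w h =>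
      Subtype.ext (List.rotate_injective 1 (congrArg Subtype.val h))

theorem toList_rotateWord_pow {G : Type*} [Finite G] {n : ℕ} (i : ℕ) (w : List.Vector G n) :
    ((rotateWord G n ^ i) w).toList = w.toList.rotate i := by
  induction i with
  | zero => simp
  | succ i ih =>
    rw [pow_succ', Equiv.Perm.mul_apply, ← List.rotate_rotate, ← ih]
    rfl

theorem exists_sum_eq_pow_mul {X : Type*} [Fintype X] (σ : Equiv.Perm X) {p n j : ℕ}
    (hp : p.Prime) (hσ : σ ^ p ^ n = 1) {F : X → ℂ} (hF : ∀ x, F (σ x) = F x)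
    (hint : ∀ x, IsIntegral ℤ (F x)) (hfix : ∀ x, (σ ^ p ^ j) x = x → F x = 0) :
    ∃ α : ℂ, IsIntegral ℤ α ∧ ∑ x, F x = (p : ℂ) ^ (j + 1) * α := by
  classical
  let Z := Subgroup.zpowers σ
  have hinv : ∀ (z : Z) (x : X), F (z • x) = F x := by
    rintro ⟨_, i, rfl⟩ x
    change F ((σ ^ i) x) = F x
    induction i with
    | zero => simp
    | succ i ih => rw [add_comm, zpow_one_add, Equiv.Perm.mul_apply, hF, ih]
    | pred i ih =>
      rw [← ih, sub_eq_neg_add, zpow_add, zpow_neg_one, Equiv.Perm.mul_apply, ← hF]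
      simp
  have hcard : ∀ x : X, ∃ α : ℂ, IsIntegral ℤ α ∧
      (Fintype.card (MulAction.orbit Z x) : ℂ) * F x = (p : ℂ) ^ (j + 1) * α := by
    intro x
    by_cases hx : F x = 0
    · exact ⟨0, isIntegral_zero, by simp [hx]⟩
    have h₁ : Function.minimalPeriod (σ • ·) x ∣ p ^ n := by
      refine Function.IsPeriodicPt.minimalPeriod_dvd ?_
      change (σ • ·)^[p ^ n] x = x
      rw [smul_iterate, hσ]
      rfl
    obtain ⟨i, -, hi⟩ := (Nat.dvd_prime_pow hp).mp h₁
    have hij : j + 1 ≤ i := by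
      by_contra! hlt
      refine hx (hfix x ?_)
      have h₂ : Function.minimalPeriod (σ • ·) x ∣ p ^ j :=
        hi ▸ pow_dvd_pow p (Nat.lt_succ_iff.mp hlt)
      have h₃ := (Function.isPeriodicPt_iff_minimalPeriod_dvd.mpr h₂).eq
      rwa [smul_iterate] at h₃
    refine ⟨(p : ℂ) ^ (i - (j + 1)) * F x, ((isIntegral_natCast p).pow _).mul (hint x), ?_⟩
    rw [← MulAction.minimalPeriod_eq_card σ x, hi, ← mul_assoc, ← pow_add,
      Nat.add_sub_cancel' hij, Nat.cast_pow]
  choose α hα hαeq using hcard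
  refine ⟨∑ ω : MulAction.orbitRel.Quotient Z X, α ω.out, IsIntegral.sum _ fun ω _ => hα _, ?_⟩
  rw [Finset.mul_sum, Fintype.sum_equiv (MulAction.selfEquivSigmaOrbits Z X) F
    (fun y => F y.2.1) (fun x => rfl), Fintype.sum_sigma]
  refine Finset.sum_congr rfl fun ω _ => ?_
  rw [← hαeq, Finset.sum_congr rfl (g := fun _ => F ω.out), Finset.sum_const, Finset.card_univ,
    nsmul_eq_mul]
  rintro ⟨_, z, rfl⟩ _
  exact hinv z _

end Words

section IrreducibleCharacters

variable {G : Type} [Group G] {χ : G → ℂ}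

theorem IsIrrChar.apply_mul_comm (hχ : IsIrrChar G χ) (g h : G) : χ (g * h) = χ (h * g) := by
  obtain ⟨V, -, rfl⟩ := hχ
  exact V.char_mul_comm h g

theorem IsIrrChar.apply_conj (hχ : IsIrrChar G χ) (g h : G) : χ (h * g * h⁻¹) = χ g := by
  rw [hχ.apply_mul_comm, inv_mul_cancel_left]

theorem IsIrrChar.isIntegral_apply [Finite G] (hχ : IsIrrChar G χ) (g : G) :
    IsIntegral ℤ (χ g) := by
  obtain ⟨V, -, rfl⟩ := hχ
  exact Representation.isIntegral_character (V.ρ : Representation ℂ G V) g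

theorem IsIrrChar.isIntegral_prod_map_inv [Finite G] (hχ : IsIrrChar G χ) (l : List G) :
    IsIntegral ℤ (l.map fun g => χ g⁻¹).prod := by
  refine list_prod_mem (S := integralClosure ℤ ℂ) fun x hx => ?_
  obtain ⟨g, -, rfl⟩ := List.mem_map.mp hx
  exact hχ.isIntegral_apply _

theorem IsIrrChar.apply_one_ne_zero [Finite G] (hχ : IsIrrChar G χ) : χ 1 ≠ 0 := by
  have := Fintype.ofFinite G
  obtain ⟨c, hc, -⟩ := hχ.exists_convolution_eq
  rintro h
  rw [h, mul_zero] at hc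
  exact NeZero.ne (Nat.card G : ℂ) hc.symm

/-- The degree of an irreducible character divides the order of the group. -/
theorem IsIrrChar.degree_dvd_card [Finite G] (hχ : IsIrrChar G χ) {r : ℕ} (hr : χ 1 = r) :
    r ∣ Nat.card G := by
  classical
  have := Fintype.ofFinite G
  obtain ⟨c, hc, hconv⟩ := hχ.exists_convolution_eq
  have hr0 : r ≠ 0 := by
    rintro rfl
    exact hχ.apply_one_ne_zero (by simpa using hr)
  have hN0 : Nat.card G ≠ 0 := Nat.card_pos.ne'
  have key : ∀ n : ℕ, r ^ n ∣ Nat.card G ^ n * r := by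
    intro n
    have h₁ := sum_words_eq_pow_mul_sum hχ.apply_mul_comm hconv n (fun x => if x = 1 then 1 else 0)
    have h₂ : IsIntegral ℤ (c ^ n * (r : ℂ)) := by
      have h₃ : c ^ n * (r : ℂ) = c ^ n * ∑ x, χ x⁻¹ * (if x = 1 then 1 else 0) := by
        simp [hr]
      rw [h₃, ← h₁]
      refine IsIntegral.sum _ fun w _ => (hχ.isIntegral_prod_map_inv _).mul ?_
      split_ifs
      exacts [isIntegral_one, isIntegral_zero]
    have h₄ : ((r ^ n : ℕ) : ℤ) ∣ ((Nat.card G ^ n * r : ℕ) : ℤ) := by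
      refine Int.dvd_of_eq_mul_isIntegral h₂ ?_
      push_cast
      rw [← hc, hr]
      ring
    exact_mod_cast h₄
  rw [← Nat.factorization_prime_le_iff_dvd hr0 hN0]
  intro ℓ _
  have h := (Nat.factorization_le_iff_dvd (pow_ne_zero _ hr0)
    (mul_ne_zero (pow_ne_zero _ hN0) hr0)).mpr (key (r.factorization ℓ + 1)) ℓ
  rw [Nat.factorization_mul (pow_ne_zero _ hN0) hr0] at h
  simp only [Nat.factorization_pow, Finsupp.coe_add, Finsupp.coe_smul, Pi.add_apply, Pi.smul_apply,
    smul_eq_mul] at h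
  by_contra! hlt
  nlinarith

theorem eq_one_of_isConj_pow_card_factorization [Finite G] {p : ℕ} (hp : p.Prime) {s y : G}
    (hs : s ^ p ^ (Nat.card G).factorization p = 1)
    (h : IsConj s (y ^ p ^ (Nat.card G).factorization p)) : s = 1 := by
  set k := (Nat.card G).factorization p
  obtain ⟨c, hc⟩ := isConj_iff.mp h
  have h₁ : y ^ p ^ (k + k) = 1 := by
    rw [pow_add, pow_mul, ← hc, conj_pow, hs]
    simp
  obtain ⟨l, -, hl⟩ := (Nat.dvd_prime_pow hp).mp (orderOf_dvd_of_pow_eq_one h₁)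
  have hlk : l ≤ k := (hp.pow_dvd_iff_le_factorization Nat.card_pos.ne').mp
    (hl ▸ orderOf_dvd_natCard y)
  have h₂ : y ^ p ^ k = 1 := orderOf_dvd_iff_pow_eq_one.mp (hl ▸ pow_dvd_pow p hlk)
  rw [h₂] at h
  exact isConj_one_left.mp h

/-- An irreducible character of `p`-defect zero vanishes on nontrivial `p`-elements. -/
theorem IsIrrChar.apply_eq_zero_of_defect_zero [Finite G] (hχ : IsIrrChar G χ) {p r m : ℕ}
    (hp : p.Prime) (hr : χ 1 = r) (hm : m * r = Nat.card G) (hpm : ¬ p ∣ m) {s : G} (hs1 : s ≠ 1)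
    (hs : s ^ p ^ (Nat.card G).factorization p = 1) : χ s = 0 := by
  classical
  have := Fintype.ofFinite G
  obtain ⟨c, hc, hconv⟩ := hχ.exists_convolution_eq
  obtain rfl : c = m := by
    refine mul_right_cancel₀ hχ.apply_one_ne_zero ?_
    rw [hc, ← hm, hr, Nat.cast_mul]
  set k := (Nat.card G).factorization p
  have hconj : ∀ {x : G}, IsConj s⁻¹ x → χ x⁻¹ = χ s := by
    intro x hx
    obtain ⟨g, rfl⟩ := isConj_iff.mp hx
    rw [← hχ.apply_conj s g]
    congr 1
    group
  let f : G → ℂ := fun x => if IsConj s⁻¹ x then 1 else 0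
  have hsum : ∑ x, χ x⁻¹ * f x = (Finset.univ.filter fun x => IsConj s⁻¹ x).card * χ s := by
    simp only [f, mul_ite, mul_one, mul_zero, ← Finset.sum_filter]
    rw [Finset.sum_congr rfl fun x hx => hconj (Finset.mem_filter.mp hx).2, Finset.sum_const,
      nsmul_eq_mul]
  have hpos : ((Finset.univ.filter fun x => IsConj s⁻¹ x).card : ℂ) ≠ 0 := by
    rw [Nat.cast_ne_zero, Finset.card_ne_zero]
    exact ⟨s⁻¹, Finset.mem_filter.mpr ⟨Finset.mem_univ _, IsConj.refl _⟩⟩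
  refine (mul_eq_zero.mp ?_).resolve_left hpos
  refine eq_zero_of_forall_pow_dvd hp hpm ((isIntegral_natCast _).mul (hχ.isIntegral_apply s)) ?_
  intro j
  obtain ⟨q, hq⟩ : ∃ q, p ^ (j + k) = q + 1 :=
    Nat.exists_eq_succ_of_ne_zero (pow_ne_zero _ hp.ne_zero)
  let F : List.Vector G (q + 1) → ℂ :=
    fun w => (w.toList.map fun g => χ g⁻¹).prod * f w.toList.prod
  have hrot : rotateWord G (q + 1) ^ p ^ (j + k) = 1 := by
    refine Equiv.ext fun w => Subtype.ext ?_
    have h := toList_rotateWord_pow (p ^ (j + k)) w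
    have hlen : p ^ (j + k) = w.toList.length := by rw [w.toList_length, hq]
    rw [hlen, List.rotate_length, ← hlen] at h
    exact h
  have hinv : ∀ w, F (rotateWord G (q + 1) w) = F w := by
    intro w
    have h := toList_rotateWord_pow 1 w
    rw [pow_one] at h
    simp only [F, h]
    congr 1
    · exact ((List.rotate_perm _ _).map _).prod_eq
    · have h₁ := List.isConj_prod_rotate w.toList 1
      simp only [f]
      congr 1
      exact propext ⟨fun h₂ => h₂.trans h₁.symm, fun h₂ => h₂.trans h₁⟩
  have hint : ∀ w, IsIntegral ℤ (F w) := by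
    intro w
    refine (hχ.isIntegral_prod_map_inv _).mul ?_
    simp only [f]
    split_ifs
    exacts [isIntegral_one, isIntegral_zero]
  have hfix : ∀ w, (rotateWord G (q + 1) ^ p ^ j) w = w → F w = 0 := by
    intro w hw
    have h := toList_rotateWord_pow (p ^ j) w
    rw [hw] at h
    obtain ⟨y, hy⟩ := List.exists_prod_eq_pow_of_rotate_eq (d := p ^ j) (e := p ^ k)
      (pow_ne_zero _ hp.ne_zero) (by rw [w.toList_length, ← hq, pow_add]) h.symm
    simp only [F, f]
    rw [if_neg, mul_zero]
    intro h₁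
    rw [hy] at h₁
    refine hs1 (inv_eq_one.mp (eq_one_of_isConj_pow_card_factorization hp ?_ h₁))
    rw [inv_pow, hs, inv_one]
  obtain ⟨α, hα, hαeq⟩ := exists_sum_eq_pow_mul _ hp hrot hinv hint hfix
  refine ⟨q, p * α, (isIntegral_natCast p).mul hα, ?_⟩
  rw [← hsum, ← sum_words_eq_pow_mul_sum hχ.apply_mul_comm hconv, ← mul_assoc, ← pow_succ]
  exact hαeq

end IrreducibleCharacters

section KnutsonIndex

variable {G : Type} [Group G] {χ : G → ℂ}

theorem isVirtualChar_regChar [Finite G] : IsVirtualChar G (regChar G) := by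
  classical
  have := Fintype.ofFinite G
  have h : regChar G = inducedFun (⊥ : Subgroup G) 1 := by
    ext g
    simp only [regChar, inducedFun, Subgroup.mem_bot, conj_eq_one_iff]
    by_cases hg : g = 1 <;> simp [hg]
  rw [h]
  exact isVirtualChar_one.inducedFun

theorem mul_regChar {d : ℕ} (h : χ 1 = d) : χ * regChar G = d • regChar G := by
  ext g
  by_cases hg : g = 1
  · simp [hg, h]
  · simp [regChar, hg]

theorem KnutsonIndex_spec [Finite G] {d : ℕ} (hd : 0 < d) (h : χ 1 = d) :
    0 < KnutsonIndex G χ ∧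
      ∃ φ : G → ℂ, IsVirtualChar G φ ∧ χ * φ = KnutsonIndex G χ • regChar G :=
  Nat.sInf_mem
    (s := {n : ℕ | 0 < n ∧ ∃ φ : G → ℂ, IsVirtualChar G φ ∧ χ * φ = n • regChar G})
    ⟨d, hd, _, isVirtualChar_regChar, mul_regChar h⟩

theorem KnutsonIndex_dvd [Finite G] {d : ℕ} (hd : 0 < d) (h : χ 1 = d) {n : ℤ} {φ : G → ℂ}
    (hφ : IsVirtualChar G φ) (hn : χ * φ = n • regChar G) : (KnutsonIndex G χ : ℤ) ∣ n := by
  obtain ⟨hpos, ψ, hψ, hK⟩ := KnutsonIndex_spec hd h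
  set K := KnutsonIndex G χ
  have hK0 : (0 : ℤ) < K := by exact_mod_cast hpos
  by_contra hndvd
  have hmod : 0 < n % K := lt_of_le_of_ne (Int.emod_nonneg _ hK0.ne')
    fun h => hndvd (Int.dvd_of_emod_eq_zero h.symm)
  have hlt : n % K < K := Int.emod_lt_of_pos _ hK0
  obtain ⟨t, ht⟩ := Int.eq_ofNat_of_zero_le hmod.le
  have hle : K ≤ t := by
    refine Nat.sInf_le ⟨by omega, φ - (n / K) • ψ,
      Submodule.sub_mem _ hφ (Submodule.smul_mem _ _ hψ), ?_⟩
    rw [mul_sub, mul_smul_comm, hn, hK, ← natCast_zsmul, ← natCast_zsmul, smul_smul, ← sub_smul,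
      ← ht, Int.emod_def, mul_comm]
  omega

theorem KnutsonIndex_dvd_degree [Finite G] {d : ℕ} (hd : 0 < d) (h : χ 1 = d) :
    KnutsonIndex G χ ∣ d := by
  have := KnutsonIndex_dvd hd h isVirtualChar_regChar (n := d) (by
    rw [mul_regChar h, natCast_zsmul])
  exact_mod_cast this

end KnutsonIndex

section SavitskiiRestriction

variable {G : Type} [Group G] {χ : G → ℂ} {H : Subgroup G} {r d m : ℕ} {u v : ℤ}

theorem savitskiiRestriction_apply_one (hr : χ 1 = r) (huv : u * r + v * Nat.card H = d) :
    (u • (fun s : H => χ s) + v • regChar H) 1 = d := by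
  have h : (u * r + v * Nat.card H : ℂ) = d := by exact_mod_cast huv
  simpa [regChar, hr] using h

theorem savitskiiRestriction_apply_of_ne_one {s : H} (hs : s ≠ 1) :
    (u • (fun s : H => χ s) + v • regChar H) s = u * χ s := by
  simp [regChar, hs]

variable [Finite G]

theorem KnutsonIndex_savitskiiRestriction_dvd (hr : χ 1 = r) (hr0 : 0 < r) (hd : 0 < d)
    (hdr : d ∣ r) (hdH : d ∣ Nat.card H) (hm : m * Nat.card H = Nat.card G)
    (hcop : (Nat.card H).Coprime m) (huv : u * r + v * Nat.card H = d) :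
    KnutsonIndex H (u • (fun s : H => χ s) + v • regChar H) ∣ KnutsonIndex G χ := by
  have h1 := savitskiiRestriction_apply_one hr huv
  obtain ⟨-, φ, hφ, hK⟩ := KnutsonIndex_spec hr0 hr
  have hL := KnutsonIndex_dvd_degree hd h1
  set K := KnutsonIndex G χ
  obtain ⟨a, ha⟩ := hφ.exists_apply_one_eq
  have har : (r * a : ℤ) = K * (m * Nat.card H) := by
    have h := congrFun hK 1
    simp only [Pi.mul_apply, Pi.smul_apply, regChar, if_true, hr, ha, nsmul_eq_mul] at h
    rw [← hm] at h
    exact_mod_cast h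
  have hdvd := KnutsonIndex_dvd hd h1 (n := u * K * m + v * a) (hφ.comap H.subtype) ?_
  · obtain ⟨r', rfl⟩ := hdr
    have ht : (u * K * m + v * a) * r' = K * m := by
      have hd0 : (d : ℤ) ≠ 0 := by exact_mod_cast hd.ne'
      refine mul_left_cancel₀ hd0 ?_
      push_cast at har huv
      linear_combination v * har + K * m * huv
    have h₂ : KnutsonIndex H (u • (fun s : H => χ s) + v • regChar H) ∣ K * m := by
      have := hdvd.mul_right (r' : ℤ)
      rw [ht] at this
      exact_mod_cast this
    exact (hcop.coprime_dvd_left (hL.trans hdH)).dvd_of_dvd_mul_right h₂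
  · funext s
    by_cases hs : s = 1
    · subst hs
      rw [Pi.mul_apply, h1]
      have h : (d * a : ℤ) = (u * K * m + v * a) * Nat.card H := by
        linear_combination u * har - a * huv
      have h' : (d * a : ℂ) = (u * K * m + v * a) * Nat.card H := by exact_mod_cast h
      simpa [regChar, ha] using h'
    · rw [Pi.mul_apply, savitskiiRestriction_apply_of_ne_one hs, mul_assoc]
      have hs' : (s : G) ≠ 1 := fun h => hs (Subtype.ext h)
      have h := congrFun hK s
      simp only [Pi.mul_apply, Pi.smul_apply, regChar, if_neg hs', smul_zero] at h
      simp [regChar, hs, h]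

theorem KnutsonIndex_dvd_of_restrict (hχ : IsIrrChar G χ) (hr : χ 1 = r) (hr0 : 0 < r) {n : ℕ}
    {ψ : H → ℂ} (hψ : IsVirtualChar H ψ) (h1 : r * ψ 1 = n * Nat.card H)
    (h : ∀ s : H, s ≠ 1 → χ s * ψ s = 0) : KnutsonIndex G χ ∣ n := by
  obtain ⟨φ, hφ, hn⟩ := exists_mul_eq_smul_regChar_of_restrict hχ.apply_conj H hψ (n := n) <| by
    funext s
    by_cases hs : s = 1
    · simpa [hs, regChar, hr] using h1
    · simpa [hs, regChar] using h s hs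
  have := KnutsonIndex_dvd hr0 hr (n := n) hφ (by rw [hn, natCast_zsmul])
  exact_mod_cast this

theorem KnutsonIndex_dvd_mul_savitskiiRestriction (hχ : IsIrrChar G χ) (hr : χ 1 = r)
    (hr0 : 0 < r) {p r' : ℕ} (hp : p.Prime) (hH : Nat.card H = p ^ (Nat.card G).factorization p)
    (hd : 0 < d) (hdr : d * r' = r) (hdH : d ∣ Nat.card H)
    (huv : u * r + v * Nat.card H = d) :
    KnutsonIndex G χ ∣ r' * KnutsonIndex H (u • (fun s : H => χ s) + v • regChar H) := by
  have h1 := savitskiiRestriction_apply_one hr huv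
  by_cases hu : u = 0
  · subst hu
    rw [zero_mul, zero_add] at huv
    have hHd : Nat.card H ∣ d := by exact_mod_cast Dvd.intro_left _ huv
    obtain ⟨q, hq⟩ := hχ.degree_dvd_card hr
    have hpq : ¬ p ∣ q := by
      rintro ⟨t, rfl⟩
      refine Nat.pow_succ_factorization_not_dvd Nat.card_pos.ne' hp (n := Nat.card G) ?_
      rw [pow_succ, ← hH]
      conv_rhs => rw [hq]
      exact mul_dvd_mul (hHd.trans (Dvd.intro _ hdr)) (dvd_mul_right _ _)
    obtain rfl : Nat.card H = d := Nat.dvd_antisymm hHd hdH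
    refine (KnutsonIndex_dvd_of_restrict hχ hr hr0 (n := r') (H := H) isVirtualChar_one ?_
      ?_).mul_right _
    · rw [← hdr]
      push_cast
      simp [mul_comm]
    · intro s hs
      rw [hχ.apply_eq_zero_of_defect_zero hp hr (by rw [hq, mul_comm]) hpq
        (fun h => hs (Subtype.ext h)), zero_mul]
      rw [← hH, ← Subgroup.coe_pow, pow_card_eq_one', Subgroup.coe_one]
  · obtain ⟨-, ψ, hψ, hL⟩ := KnutsonIndex_spec hd h1
    refine KnutsonIndex_dvd_of_restrict hχ hr hr0 hψ ?_ fun s hs => ?_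
    · have h := congrFun hL 1
      rw [Pi.mul_apply, h1] at h
      simp only [Pi.smul_apply, regChar, if_true, nsmul_eq_mul] at h
      rw [← hdr]
      push_cast
      linear_combination (r' : ℂ) * h
    · have h := congrFun hL s
      rw [Pi.mul_apply, savitskiiRestriction_apply_of_ne_one hs, mul_assoc] at h
      simpa [regChar, hs, hu] using h

end SavitskiiRestriction

/-- The Knutson index of an irreducible character `χ` of a finite group
`G` equals the product over primes `p` dividing `|G|` of the Knutson indices of the
Savitskii restrictions `χ_p = u_p·(χ|_{S_p}) + v_p·ρ_reg^{S_p}` to Sylow `p`-subgroups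
`S_p`, where `u_p·r + v_p·p^{k_p} = gcd(r, p^{k_p})` and `r = χ(1)`.  In particular the
product does not depend on the choice of the Bézout coefficients `u_p, v_p`. -/
theorem knutson_index_eq_prod_savitskii_restrictions {G : Type} [Group G] [Finite G]
    (χ : G → ℂ) (hχ : IsIrrChar G χ) (r : ℕ) (hr : χ 1 = (r : ℂ))
    (S : ℕ → Subgroup G)
    (hS : ∀ p ∈ (Nat.card G).primeFactors,
      Nat.card (S p) = p ^ (Nat.card G).factorization p)
    (u v : ℕ → ℤ)
    (huv : ∀ p ∈ (Nat.card G).primeFactors,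
      u p * r + v p * (p ^ (Nat.card G).factorization p : ℕ) =
        (Nat.gcd r (p ^ (Nat.card G).factorization p) : ℤ)) :
    KnutsonIndex G χ =
      ∏ p ∈ (Nat.card G).primeFactors,
        KnutsonIndex (S p)
          (u p • (fun s : S p => χ (s : G)) + v p • regChar (S p)) := by
  have hr0 : 0 < r := Nat.pos_of_ne_zero fun h => hχ.apply_one_ne_zero (by simp [hr, h])
  have hrN := hχ.degree_dvd_card hr
  have hd : ∀ p, 0 < r.gcd (Nat.card (S p)) := fun p => Nat.gcd_pos_of_pos_left _ hr0
  have huv' : ∀ p ∈ (Nat.card G).primeFactors,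
      u p * r + v p * Nat.card (S p) = (r.gcd (Nat.card (S p)) : ℕ) := fun p hp => by
    rw [hS p hp]
    exact huv p hp
  set L : ℕ → ℕ := fun p =>
    KnutsonIndex (S p) (u p • (fun s : S p => χ (s : G)) + v p • regChar (S p))
  have hL : ∀ p ∈ (Nat.card G).primeFactors, 0 < L p ∧ L p ∣ p ^ (Nat.card G).factorization p := by
    intro p hp
    have h1 := savitskiiRestriction_apply_one hr (huv' p hp)
    exact ⟨(KnutsonIndex_spec (hd p) h1).1,
      hS p hp ▸ (KnutsonIndex_dvd_degree (hd p) h1).trans (Nat.gcd_dvd_right _ _)⟩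
  have hprod : (∏ p ∈ (Nat.card G).primeFactors, L p) ≠ 0 :=
    Finset.prod_ne_zero_iff.mpr fun p hp => (hL p hp).1.ne'
  have hK := (KnutsonIndex_spec hr0 hr).1
  refine Nat.dvd_antisymm ?_ ?_
  · rw [← Nat.factorization_prime_le_iff_dvd hK.ne' hprod]
    intro p hp
    by_cases hpN : p ∣ Nat.card G
    · have hpf : p ∈ (Nat.card G).primeFactors :=
        Nat.mem_primeFactors.mpr ⟨hp, hpN, Nat.card_pos.ne'⟩
      obtain ⟨r', hr'⟩ := Nat.gcd_dvd_left r (Nat.card (S p))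
      have hr'0 : r' ≠ 0 := by
        rintro rfl
        exact hr0.ne' hr'
      have hpr' : ¬ p ∣ r' := by
        rintro ⟨t, rfl⟩
        obtain ⟨i, hik, hi⟩ := (Nat.dvd_prime_pow hp).mp
          (hS p hpf ▸ Nat.gcd_dvd_right r (Nat.card (S p)))
        have hir : p ^ (i + 1) ∣ r := by
          rw [hr', hS p hpf, hi, ← mul_assoc, ← pow_succ]
          exact dvd_mul_right _ _
        have hiN := (hp.pow_dvd_iff_le_factorization Nat.card_pos.ne').mp (hir.trans hrN)
        have h := Nat.dvd_gcd hir (pow_dvd_pow p hiN)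
        rw [hi, Nat.pow_dvd_pow_iff_le_right hp.one_lt] at h
        omega
      have h := KnutsonIndex_dvd_mul_savitskiiRestriction hχ hr hr0 hp (hS p hpf) (hd p) hr'.symm
        (Nat.gcd_dvd_right _ _) (huv' p hpf)
      have h₂ := (Nat.factorization_prime_le_iff_dvd hK.ne'
        (mul_ne_zero hr'0 (hL p hpf).1.ne')).mpr h p hp
      rw [Nat.factorization_mul hr'0 (hL p hpf).1.ne', Finsupp.add_apply,
        Nat.factorization_eq_zero_of_not_dvd hpr', zero_add] at h₂
      exact h₂.trans ((Nat.factorization_prime_le_iff_dvd (hL p hpf).1.ne' hprod).mpr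
        (Finset.dvd_prod_of_mem L hpf) p hp)
    · rw [Nat.factorization_eq_zero_of_not_dvd fun h =>
        hpN ((h.trans (KnutsonIndex_dvd_degree hr0 hr)).trans hrN)]
      exact Nat.zero_le _
  · refine Finset.prod_dvd_of_isRelPrime ?_ ?_
    · intro p hp q hq hpq
      have := (Nat.coprime_primes (Nat.prime_of_mem_primeFactors hp)
        (Nat.prime_of_mem_primeFactors hq)).mpr hpq
      exact Nat.coprime_iff_isRelPrime.mp
        (((this.pow _ _).coprime_dvd_left (hL p hp).2).coprime_dvd_right (hL q hq).2)
    · intro p hp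
      refine KnutsonIndex_savitskiiRestriction_dvd hr hr0 (hd p) (Nat.gcd_dvd_left _ _)
        (Nat.gcd_dvd_right _ _) (m := Nat.card G / p ^ (Nat.card G).factorization p) ?_ ?_
        (huv' p hp)
      · rw [hS p hp]
        exact Nat.div_mul_cancel (Nat.ordProj_dvd _ _)
      · rw [hS p hp]
        exact (Nat.coprime_ordCompl (Nat.prime_of_mem_primeFactors hp) Nat.card_pos.ne').pow_left _
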